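/- arXiv:math/0501069 — 2 statements merged into one kernel-verified Lean document; each statement's English description precedes it below -/
import Mathlib

section
/- Let ε, ε̃ ∈ {0, 1} with ε ≠ ε̃, let f₅, f₆ : ℝ → ℝ be C² functions whose derivatives f₅′, f₆′ are nowhere zero, and let φ : ℝ⁶ → ℝ be a C² function satisfying, at every point x = (x¹,…,x⁶) ∈ ℝ⁶ and for each τ ∈ {5, 6}: (i) ∂₁φ = 0 and ∂₃φ = 0; (ii) ∂₅∂₆φ = 0; (iii) 2ε·∂_τφ(x) = f_τ′(x^τ)·∂₂φ(x); (iv) ∂₂∂_τφ = 0; (v) f_τ′(x^τ)·∂_τ∂_τφ(x) = f_τ″(x^τ)·∂_τφ(x); (vi) ε·∂₄φ(x) = ε̃·∂₂φ(x); (vii) ∂₂∂₄φ = 0; (viii) 2ε̃·∂_τφ(x) = f_τ′(x^τ)·∂₄φ(x); (ix) ∂₄∂_τφ = 0. Then there exist constants a₁, c ∈ ℝ such that φ(x) = a₁(ε·x² + ε̃·x⁴) + (a₁/2)(f₅(x⁵) + f₆(x⁶)) + c for all x ∈ ℝ⁶. -/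
/-- Partial derivative of `φ : ℝ⁶ → ℝ` in the `i`-th coordinate direction
(`i : Fin 6` is the 0-based index, so `∂ᵢφ` of the paper is `pd (i-1) φ`). -/
noncomputable def pd (i : Fin 6) (φ : (Fin 6 → ℝ) → ℝ) : (Fin 6 → ℝ) → ℝ :=
  fun x => fderiv ℝ φ x (Pi.single i 1)

lemma contDiff_pd {φ : (Fin 6 → ℝ) → ℝ} (hφ : ContDiff ℝ 2 φ) (i : Fin 6) :
    ContDiff ℝ 1 (pd i φ) :=
  (hφ.fderiv_right (m := 1) (by norm_num)).clm_apply contDiff_const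

lemma pd_comm {φ : (Fin 6 → ℝ) → ℝ} (hφ : ContDiff ℝ 2 φ) (i j : Fin 6) (x : Fin 6 → ℝ) :
    pd i (pd j φ) x = pd j (pd i φ) x := by
  have hd : DifferentiableAt ℝ (fderiv ℝ φ) x :=
    ((hφ.fderiv_right (m := 1) (by norm_num)).differentiable (by norm_num)) x
  have key (k l : Fin 6) : pd k (pd l φ) x =
      fderiv ℝ (fderiv ℝ φ) x (Pi.single k 1) (Pi.single l 1) := by
    have h := hd.hasFDerivAt.clm_apply (hasFDerivAt_const (Pi.single l 1 : Fin 6 → ℝ) x)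
    have h' : HasFDerivAt (pd l φ) _ x := h
    rw [pd, h'.fderiv]
    simp
  rw [key, key]
  exact (hφ.contDiffAt.isSymmSndFDerivAt (by simp)) _ _

lemma eq_of_pd_eq_zero {g : (Fin 6 → ℝ) → ℝ} (hg : Differentiable ℝ g)
    (h : ∀ i x, pd i g x = 0) (x y : Fin 6 → ℝ) : g x = g y := by
  refine is_const_of_fderiv_eq_zero hg (fun z => ?_) x y
  ext v
  have hv : v = ∑ i, v i • (Pi.single i 1 : Fin 6 → ℝ) := by
    simpa using pi_eq_sum_univ' v
  rw [hv, map_sum]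
  exact Finset.sum_eq_zero fun i _ => by
    rw [map_smul, show fderiv ℝ g z (Pi.single i 1) = 0 from h i z, smul_zero]

lemma hasFDerivAt_comp_apply {f : ℝ → ℝ} (hf : Differentiable ℝ f) (j : Fin 6)
    (x : Fin 6 → ℝ) :
    HasFDerivAt (fun y : Fin 6 → ℝ => f (y j))
      (deriv f (x j) • (ContinuousLinearMap.proj j : (Fin 6 → ℝ) →L[ℝ] ℝ)) x :=
  (hf (x j)).hasDerivAt.comp_hasFDerivAt x (hasFDerivAt_apply j x)

/-- The system in the case where only the direction `k` of `x 1`, `x 3` is active. -/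
lemma exists_eq_of_pd {f₅ f₆ : ℝ → ℝ} (hf₅ : ContDiff ℝ 2 f₅) (hf₆ : ContDiff ℝ 2 f₆)
    (hf₅' : ∀ s, deriv f₅ s ≠ 0) {φ : (Fin 6 → ℝ) → ℝ} (hφ : ContDiff ℝ 2 φ)
    {k : Fin 6} (hk4 : k ≠ 4) (hk5 : k ≠ 5)
    (h0 : ∀ i, i ≠ k → i ≠ 4 → i ≠ 5 → ∀ x, pd i φ x = 0)
    (h4 : ∀ x, 2 * pd 4 φ x = deriv f₅ (x 4) * pd k φ x)
    (h5 : ∀ x, 2 * pd 5 φ x = deriv f₆ (x 5) * pd k φ x)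
    (hk4φ : ∀ x, pd k (pd 4 φ) x = 0) (hk5φ : ∀ x, pd k (pd 5 φ) x = 0) :
    ∃ a c : ℝ, ∀ x, φ x = a * x k + a / 2 * (f₅ (x 4) + f₆ (x 5)) + c := by
  have hd (i : Fin 6) : Differentiable ℝ (pd i φ) := (contDiff_pd hφ i).differentiable (by norm_num)
  have hf₅d : Differentiable ℝ f₅ := hf₅.differentiable (by norm_num)
  have hf₆d : Differentiable ℝ f₆ := hf₆.differentiable (by norm_num)
  have hf₅dd : Differentiable ℝ (deriv f₅) :=
    (ContDiff.deriv' (n := 1) hf₅).differentiable (by norm_num)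
  have hkk (x) : pd k (pd k φ) x = 0 := by
    have hl := ((hd 4) x).hasFDerivAt.const_mul 2
    have hr := (hasFDerivAt_comp_apply hf₅dd 4 x).mul ((hd k) x).hasFDerivAt
    have he := hl.unique (hr.congr_of_eventuallyEq (.of_forall h4))
    have he' := congrArg (fun L => L (Pi.single k 1)) he
    have h4' : fderiv ℝ (pd 4 φ) x (Pi.single k 1) = 0 := hk4φ x
    change fderiv ℝ (pd k φ) x (Pi.single k 1) = 0
    simpa [h4', hk4, hk4.symm, hf₅'] using he'
  have hconst (x) : pd k φ x = pd k φ 0 := by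
    refine eq_of_pd_eq_zero (hd k) (fun i x => ?_) x 0
    by_cases hik : i = k
    · rw [hik, hkk]
    rw [pd_comm hφ]
    by_cases hi4 : i = 4
    · rw [hi4, hk4φ]
    by_cases hi5 : i = 5
    · rw [hi5, hk5φ]
    rw [show pd i φ = fun _ => 0 from funext (h0 i hik hi4 hi5)]
    simp [pd]
  set a := pd k φ 0
  have hg (x) := ((hφ.differentiable (by norm_num)) x).hasFDerivAt.sub
    (((hasFDerivAt_apply (𝕜 := ℝ) k x).const_mul a).add
    (((hasFDerivAt_comp_apply hf₅d 4 x).add (hasFDerivAt_comp_apply hf₆d 5 x)).const_mul (a / 2)))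
  have hg0 := eq_of_pd_eq_zero (fun x => (hg x).differentiableAt) fun i x => by
    rw [pd, (hg x).fderiv]
    have h4x := h4 x
    have h5x := h5 x
    rw [hconst] at h4x h5x
    have hi : fderiv ℝ φ x (Pi.single i 1) = pd i φ x := rfl
    by_cases hik : i = k
    · subst hik
      simp [hi, hk4.symm, hk5.symm, hconst]
    by_cases hi4 : i = 4
    · subst hi4
      simp [hi, hk4]
      linarith
    by_cases hi5 : i = 5
    · subst hi5
      simp [hi, hk5]
      linarith
    simp [hi, h0 i hik hi4 hi5, Ne.symm hik, Ne.symm hi4, Ne.symm hi5]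
  refine ⟨a, φ 0 - (a * (0 : Fin 6 → ℝ) k + a / 2 * (f₅ 0 + f₆ 0)), fun x => ?_⟩
  have h := hg0 x 0
  simp only [Pi.sub_apply, Pi.add_apply, Pi.zero_apply] at h ⊢
  linarith

/-- Integration of the Eisenhart equations for the defining function of a
projective motion on the rigid 6-dimensional h-space of type [2211] (generic case
f₅′, f₆′ nowhere zero). Coordinates: x¹,…,x⁶ are `x 0, …, x 5`. -/
theorem stmt_1 (ε ε' : ℝ) (hε : ε = 0 ∨ ε = 1) (hε' : ε' = 0 ∨ ε' = 1) (hne : ε ≠ ε')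
    (f₅ f₆ : ℝ → ℝ) (hf₅ : ContDiff ℝ 2 f₅) (hf₆ : ContDiff ℝ 2 f₆)
    (hf₅' : ∀ s : ℝ, deriv f₅ s ≠ 0) (hf₆' : ∀ t : ℝ, deriv f₆ t ≠ 0)
    (φ : (Fin 6 → ℝ) → ℝ) (hφ : ContDiff ℝ 2 φ)
    -- (i) ∂₁φ = 0, ∂₃φ = 0
    (h1 : ∀ x, pd 0 φ x = 0) (h3 : ∀ x, pd 2 φ x = 0)
    -- (ii) ∂₅∂₆φ = 0
    (h56 : ∀ x, pd 4 (pd 5 φ) x = 0)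
    -- (iii) 2ε·∂_τφ = f_τ′·∂₂φ  (τ = 5, 6)
    (h2τ5 : ∀ x, 2 * ε * pd 4 φ x = deriv f₅ (x 4) * pd 1 φ x)
    (h2τ6 : ∀ x, 2 * ε * pd 5 φ x = deriv f₆ (x 5) * pd 1 φ x)
    -- (iv) ∂₂∂_τφ = 0  (τ = 5, 6)
    (h25 : ∀ x, pd 1 (pd 4 φ) x = 0) (h26 : ∀ x, pd 1 (pd 5 φ) x = 0)
    -- (v) f_τ′·∂_τ∂_τφ = f_τ″·∂_τφ  (τ = 5, 6)
    (h55 : ∀ x, deriv f₅ (x 4) * pd 4 (pd 4 φ) x = deriv (deriv f₅) (x 4) * pd 4 φ x)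
    (h66 : ∀ x, deriv f₆ (x 5) * pd 5 (pd 5 φ) x = deriv (deriv f₆) (x 5) * pd 5 φ x)
    -- (vi) ε·∂₄φ = ε̃·∂₂φ
    (h24 : ∀ x, ε * pd 3 φ x = ε' * pd 1 φ x)
    -- (vii) ∂₂∂₄φ = 0
    (h24' : ∀ x, pd 1 (pd 3 φ) x = 0)
    -- (viii) 2ε̃·∂_τφ = f_τ′·∂₄φ  (τ = 5, 6)
    (h4τ5 : ∀ x, 2 * ε' * pd 4 φ x = deriv f₅ (x 4) * pd 3 φ x)
    (h4τ6 : ∀ x, 2 * ε' * pd 5 φ x = deriv f₆ (x 5) * pd 3 φ x)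
    -- (ix) ∂₄∂_τφ = 0  (τ = 5, 6)
    (h45 : ∀ x, pd 3 (pd 4 φ) x = 0) (h46 : ∀ x, pd 3 (pd 5 φ) x = 0) :
    ∃ a₁ c : ℝ, ∀ x : Fin 6 → ℝ,
      φ x = a₁ * (ε * x 1 + ε' * x 3) + (a₁ / 2) * (f₅ (x 4) + f₆ (x 5)) + c := by
  have hcases : ε = 1 ∧ ε' = 0 ∨ ε = 0 ∧ ε' = 1 := by
    rcases hε with rfl | rfl <;> rcases hε' with rfl | rfl <;> simp_all
  rcases hcases with ⟨rfl, rfl⟩ | ⟨rfl, rfl⟩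
  · have h4 : ∀ x, pd 3 φ x = 0 := by simpa using h24
    obtain ⟨a, c, h⟩ := exists_eq_of_pd (k := 1) hf₅ hf₆ hf₅' hφ (by decide) (by decide)
      (fun i _ _ _ => by fin_cases i <;> first | assumption | contradiction)
      (by simpa using h2τ5) (by simpa using h2τ6) h25 h26
    exact ⟨a, c, by simpa using h⟩
  · have h2 : ∀ x, pd 1 φ x = 0 := fun x => by simpa using (h24 x).symm
    obtain ⟨a, c, h⟩ := exists_eq_of_pd (k := 3) hf₅ hf₆ hf₅' hφ (by decide) (by decide)
      (fun i _ _ _ => by fin_cases i <;> first | assumption | contradiction)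
      (by simpa using h4τ5) (by simpa using h4τ6) h45 h46
    exact ⟨a, c, by simpa using h⟩
end

section
/- Let ε, ε̃ ∈ {0, 1} with ε ≠ ε̃, and let φ : ℝ⁶ → ℝ be a C² function satisfying, at every point of ℝ⁶ and for each τ ∈ {5, 6}: (i) ∂₁φ = 0 and ∂₃φ = 0; (ii) ε·∂_τφ = 0 and ε̃·∂_τφ = 0; (iii) ε·∂₄φ = ε̃·∂₂φ; (iv) ∂₂∂₄φ = 0, ∂₂∂₂φ = 0, ∂₄∂₄φ = 0, ∂₂∂_τφ = 0, ∂₄∂_τφ = 0 and ∂₅∂₆φ = 0. Then there exist constants a₁, c ∈ ℝ such that φ(x) = a₁(ε·x² + ε̃·x⁴) + c for all x ∈ ℝ⁶. -/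
/-- A differentiable function whose derivative in the direction `v` vanishes along the line
through `z` with direction `v` takes the same value at `z` and `z + v`. -/
theorem apply_add_eq_of_fderiv_eq_zero {E : Type*} [NormedAddCommGroup E] [NormedSpace ℝ E]
    {f : E → ℝ} (hf : Differentiable ℝ f) {z v : E}
    (h : ∀ s : ℝ, fderiv ℝ f (z + s • v) v = 0) : f (z + v) = f z := by
  have hd : ∀ s : ℝ, HasDerivAt (fun s : ℝ => f (z + s • v)) 0 s := fun s => by
    have hl : HasDerivAt (fun s : ℝ => z + s • v) v s := by
      simpa using ((hasDerivAt_id s).smul_const v).const_add z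
    simpa only [Function.comp_def, h s] using (hf _).hasFDerivAt.comp_hasDerivAt s hl
  simpa using is_const_of_deriv_eq_zero (fun s => (hd s).differentiableAt)
    (fun s => (hd s).deriv) 1 0

/-- The derivative expands in partial derivatives. -/
theorem fderiv_apply_eq_sum_pd (φ : (Fin 6 → ℝ) → ℝ) (x v : Fin 6 → ℝ) :
    fderiv ℝ φ x v = ∑ j, v j * pd j φ x := by
  have hv : v = ∑ j, v j • (Pi.single j 1 : Fin 6 → ℝ) := by
    simpa only [← Pi.single_smul, smul_eq_mul, mul_one] using (Finset.univ_sum_single v).symm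
  conv_lhs => rw [hv]
  simp only [map_sum, map_smul, smul_eq_mul, pd]

/-- A function depending on one coordinate only, with vanishing second derivative in that
coordinate, is affine in it. -/
theorem exists_affine_of_pd_eq_zero {φ : (Fin 6 → ℝ) → ℝ} (hφ : ContDiff ℝ 2 φ) (i : Fin 6)
    (h : ∀ j, j ≠ i → ∀ x, pd j φ x = 0) (hi : ∀ x, pd i (pd i φ) x = 0) :
    ∃ a c : ℝ, ∀ x, φ x = a * x i + c := by
  have hd : Differentiable ℝ φ := hφ.differentiable (by norm_num)
  have hpd : Differentiable ℝ (pd i φ) :=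
    ((hφ.fderiv_right (m := 1) (by norm_num)).clm_apply contDiff_const).differentiable
      (by norm_num)
  have hfd (x v : Fin 6 → ℝ) : fderiv ℝ φ x v = v i * pd i φ x := by
    rw [fderiv_apply_eq_sum_pd]
    exact Finset.sum_eq_single i (fun j _ hj => by rw [h j hj, mul_zero]) (by simp)
  have hline (t : ℝ) : pd i φ (t • Pi.single i 1) = pd i φ 0 := by
    have := apply_add_eq_of_fderiv_eq_zero hpd (z := 0) (v := t • Pi.single i 1) fun s => by
      rw [map_smul]
      exact smul_eq_zero_of_right t (hi _)
    simpa only [zero_add] using this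
  refine ⟨pd i φ 0, φ 0, fun x => ?_⟩
  have hproj : φ x = φ (x i • Pi.single i 1) := by
    have := apply_add_eq_of_fderiv_eq_zero hd (z := x i • Pi.single i 1)
      (v := x - x i • Pi.single i 1) fun s => by rw [hfd]; simp
    simpa only [add_sub_cancel] using this
  let L : (Fin 6 → ℝ) →L[ℝ] ℝ := pd i φ 0 • ContinuousLinearMap.proj i
  have haff := apply_add_eq_of_fderiv_eq_zero (f := fun y => φ y - L y)
    (hd.sub L.differentiable) (z := 0) (v := x i • Pi.single i 1) fun s => by
      rw [fderiv_fun_sub (hd _) L.differentiableAt, L.fderiv, _root_.sub_apply, hfd,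
        zero_add, smul_smul, hline]
      simp [L, mul_comm]
  rw [hproj]
  simp [L] at haff
  linarith

/-- Degenerate case (f₅′ = f₆′ = 0) of the integration of the Eisenhart
equations for the defining function on the rigid h-space of type [2211].
Coordinates: x¹,…,x⁶ are `x 0, …, x 5`. -/
theorem stmt_2 (ε ε' : ℝ) (hε : ε = 0 ∨ ε = 1) (hε' : ε' = 0 ∨ ε' = 1) (hne : ε ≠ ε')
    (φ : (Fin 6 → ℝ) → ℝ) (hφ : ContDiff ℝ 2 φ)
    -- (i) ∂₁φ = 0, ∂₃φ = 0
    (h1 : ∀ x, pd 0 φ x = 0) (h3 : ∀ x, pd 2 φ x = 0)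
    -- (ii) ε·∂_τφ = 0 and ε̃·∂_τφ = 0  (τ = 5, 6)
    (hε5 : ∀ x, ε * pd 4 φ x = 0) (hε6 : ∀ x, ε * pd 5 φ x = 0)
    (hε'5 : ∀ x, ε' * pd 4 φ x = 0) (hε'6 : ∀ x, ε' * pd 5 φ x = 0)
    -- (iii) ε·∂₄φ = ε̃·∂₂φ
    (h24 : ∀ x, ε * pd 3 φ x = ε' * pd 1 φ x)
    -- (iv) second-order conditions
    (h24' : ∀ x, pd 1 (pd 3 φ) x = 0)
    (h22 : ∀ x, pd 1 (pd 1 φ) x = 0)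
    (h44 : ∀ x, pd 3 (pd 3 φ) x = 0)
    (h25 : ∀ x, pd 1 (pd 4 φ) x = 0) (h26 : ∀ x, pd 1 (pd 5 φ) x = 0)
    (h45 : ∀ x, pd 3 (pd 4 φ) x = 0) (h46 : ∀ x, pd 3 (pd 5 φ) x = 0)
    (h56 : ∀ x, pd 4 (pd 5 φ) x = 0) :
    ∃ a₁ c : ℝ, ∀ x : Fin 6 → ℝ, φ x = a₁ * (ε * x 1 + ε' * x 3) + c := by
  have hφ' := exists_affine_of_pd_eq_zero hφ
  rcases hε with rfl | rfl <;> rcases hε' with rfl | rfl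
  · exact absurd rfl hne
  · obtain ⟨a, c, h⟩ := hφ' 3 (fun j hj x => by
      fin_cases j
      · exact h1 x
      · simpa using (h24 x).symm
      · exact h3 x
      · exact absurd rfl hj
      · simpa using hε'5 x
      · simpa using hε'6 x) h44
    exact ⟨a, c, fun x => by simpa using h x⟩
  · obtain ⟨a, c, h⟩ := hφ' 1 (fun j hj x => by
      fin_cases j
      · exact h1 x
      · exact absurd rfl hj
      · exact h3 x
      · simpa using h24 x
      · simpa using hε5 x
      · simpa using hε6 x) h22
    exact ⟨a, c, fun x => by simpa using h x⟩
  · exact absurd rfl hne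
end
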